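/- Erdős–Simonovits supersaturation: for all positive integers ℓ and t and every ε > 0 there exists δ > 0 such that every ℓ-uniform hypergraph H on n vertices with at least ε·C(n,ℓ) edges contains at least ⌊δ·n^{ℓt}⌋ copies (not necessarily induced) of the complete ℓ-partite ℓ-uniform hypergraph K^ℓ(t) with t vertices in each class. -/

import Mathlib

open Finset in
lemma es_sum_cons {V : Type} [Fintype V] [DecidableEq V] (l : ℕ) (W : Type) [Fintype W]
    (P : (Fin (l+1) → W) → Prop) [DecidablePred P] :
    #{f | P f} = ∑ y : W, #{x : Fin l → W | P (Fin.cons y x)} := by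
  simp only [Finset.card_filter]
  rw [← Fintype.sum_prod_type' (f := fun y x => if P (Fin.cons y x) then 1 else 0)]
  symm
  exact Fintype.sum_equiv (Fin.consEquiv fun _ => W) _ _ (fun x => rfl)

open Finset in
lemma es_jensen {ι : Type} [Fintype ι] [Nonempty ι] (f : ι → ℝ) (hf : ∀ i, 0 ≤ f i) (k : ℕ)
    (hk : 0 < k) :
    ((∑ i, f i) / Fintype.card ι) ^ k * Fintype.card ι ≤ ∑ i, f i ^ k := by
  obtain ⟨k, rfl⟩ : ∃ j, k = j + 1 := ⟨k - 1, by omega⟩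
  have h := pow_sum_div_card_le_sum_pow (s := (univ : Finset ι)) (f := f) (fun i _ => hf i) k
  have hc : (0:ℝ) < Fintype.card ι := by exact_mod_cast Fintype.card_pos
  refine le_trans (le_of_eq ?_) h
  rw [Finset.card_univ, div_pow]
  field_simp
  ring

open Finset in
lemma es_hom {V : Type} [Fintype V] [DecidableEq V] [Nonempty V] (t : ℕ) (ht : 0 < t) :
    ∀ (l : ℕ) (A : Finset (Fin l → V)),
      ((#A : ℝ) / (Fintype.card V : ℝ) ^ l) ^ (t ^ l) * (Fintype.card V : ℝ) ^ (l * t) ≤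
      (#{f : Fin l → Fin t → V | ∀ g : Fin l → Fin t, (fun i => f i (g i)) ∈ A} : ℝ) := by
  have hc : (0:ℝ) < Fintype.card V := by exact_mod_cast Fintype.card_pos
  intro l
  induction l with
  | zero =>
    intro A
    rcases A.eq_empty_or_nonempty with rfl | ⟨a, ha⟩
    · simp
    · have h1 : #A ≤ 1 := Finset.card_le_one_of_subsingleton A
      have : (univ.filter fun f : Fin 0 → Fin t → V =>
          ∀ g : Fin 0 → Fin t, (fun i => f i (g i)) ∈ A) = univ := by
        ext f
        simp only [mem_filter, mem_univ, true_and, iff_true]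
        intro g
        convert ha
      rw [this]
      simpa using h1
  | succ l ih =>
    intro A
    set n : ℝ := (Fintype.card V : ℝ) with hn
    let B : (Fin t → V) → Finset (Fin l → V) := fun y => {x | ∀ j, (Fin.cons (y j) x : Fin (l+1) → V) ∈ A}
    let d : (Fin l → V) → ℕ := fun x => #{v : V | (Fin.cons v x : Fin (l+1) → V) ∈ A}
    have hA : #A = ∑ x, d x := by
      have h := es_sum_cons (V := V) l V (fun f => f ∈ A)
      simp only [Finset.filter_univ_mem] at h
      rw [h]
      simp only [d, Finset.card_filter]
      exact Finset.sum_comm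
    have hB : ∑ y, #(B y) = ∑ x, d x ^ t := by
      simp only [B, Finset.card_filter]
      rw [Finset.sum_comm]
      refine Finset.sum_congr rfl fun x _ => ?_
      rw [← Finset.card_filter]
      have : (univ.filter fun y : Fin t → V => ∀ j, (Fin.cons (y j) x : Fin (l+1) → V) ∈ A)
          = Fintype.piFinset fun _ : Fin t => ({v : V | (Fin.cons v x : Fin (l+1) → V) ∈ A} : Finset V) := by
        ext y
        simp
      rw [this, Fintype.card_piFinset]
      simp [d]
    have hN : #{f : Fin (l+1) → Fin t → V | ∀ g : Fin (l+1) → Fin t, (fun i => f i (g i)) ∈ A}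
        = ∑ y, #{f : Fin l → Fin t → V | ∀ g : Fin l → Fin t, (fun i => f i (g i)) ∈ B y} := by
      rw [es_sum_cons (V := V)]
      refine Finset.sum_congr rfl fun y _ => ?_
      congr 1
      ext f
      simp only [mem_filter, mem_univ, true_and, B]
      have key : ∀ (j : Fin t) (g : Fin l → Fin t),
          (fun i : Fin (l+1) => (Fin.cons y f : Fin (l+1) → Fin t → V) i ((Fin.cons j g : Fin (l+1) → Fin t) i))
           = (Fin.cons (y j) (fun i => f i (g i)) : Fin (l+1) → V) := by
        intro j g
        funext i
        refine Fin.cases ?_ (fun i => ?_) i <;> simp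
      constructor
      · intro h g j
        rw [← key]
        exact h _
      · intro h g
        have := h (Fin.tail g) (g 0)
        rw [← key, Fin.cons_self_tail] at this
        exact this
    rw [hN]
    push_cast
    have hd := es_jensen (fun x => (d x : ℝ)) (fun x => Nat.cast_nonneg _) t ht
    have hb := es_jensen (fun y => (#(B y) : ℝ) / n ^ l) (fun x => by positivity) (t ^ l) (by positivity)
    have hA' : (#A : ℝ) = ∑ x, (d x : ℝ) := by exact_mod_cast hA
    have hB' : ∑ y, (#(B y) : ℝ) = ∑ x, (d x : ℝ) ^ t := by exact_mod_cast hB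
    rw [← hA', ← hB'] at hd
    rw [← Finset.sum_div] at hb
    simp only [Fintype.card_pi, Finset.prod_const, Finset.card_univ, Fintype.card_fin, Nat.cast_pow, ← hn] at hd hb
    have step : ((#A : ℝ) / n ^ (l+1)) ^ t ≤ (∑ y, (#(B y) : ℝ)) / n ^ l / n ^ t := by
      rw [le_div_iff₀ (by positivity), le_div_iff₀ (by positivity)]
      refine le_trans (le_of_eq ?_) hd
      rw [pow_succ n l, ← div_div, div_pow _ n]
      field_simp
    calc ((#A : ℝ) / n ^ (l+1)) ^ (t ^ (l+1)) * n ^ ((l+1) * t)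
        = (((#A : ℝ) / n ^ (l+1)) ^ t) ^ (t ^ l) * n ^ t * n ^ (l * t) := by
          rw [← pow_mul, pow_succ' t l, mul_assoc, ← pow_add]; ring_nf
      _ ≤ ((∑ y, (#(B y) : ℝ)) / n ^ l / n ^ t) ^ (t ^ l) * n ^ t * n ^ (l * t) := by
          gcongr
      _ ≤ (∑ y, ((#(B y) : ℝ) / n ^ l) ^ (t ^ l)) * n ^ (l * t) := by gcongr
      _ = ∑ y, ((#(B y) : ℝ) / n ^ l) ^ (t ^ l) * n ^ (l * t) := by rw [Finset.sum_mul]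
      _ ≤ _ := Finset.sum_le_sum fun y _ => ih (B y)

open Finset in
lemma es_noninj {ι V : Type} [Fintype ι] [DecidableEq ι] [Fintype V] [DecidableEq V] :
    #{f : ι → V | ¬ Function.Injective f} * Fintype.card V ≤
      Fintype.card ι ^ 2 * Fintype.card V ^ Fintype.card ι := by
  have h1 : (univ.filter fun f : ι → V => ¬ Function.Injective f) ⊆
      (univ.filter fun p : ι × ι => p.1 ≠ p.2).biUnion fun p => {f : ι → V | f p.1 = f p.2} := by
    intro f hf
    have hf' : ¬ Function.Injective f := (mem_filter.1 hf).2
    unfold Function.Injective at hf'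
    push Not at hf'
    obtain ⟨a, b, h, hne⟩ := hf'
    simp only [mem_biUnion, mem_filter, mem_univ, true_and]
    exact ⟨(a, b), hne, h⟩
  have h2 : ∀ p ∈ (univ.filter fun p : ι × ι => p.1 ≠ p.2),
      #{f : ι → V | f p.1 = f p.2} * Fintype.card V ≤ Fintype.card V ^ Fintype.card ι := by
    rintro ⟨a, b⟩ hp
    simp only [mem_filter, mem_univ, true_and] at hp
    rw [← Finset.card_univ (α := V), ← Finset.card_product]
    have : Fintype.card V ^ Fintype.card ι = #(univ : Finset (ι → V)) := by simp
    rw [Finset.card_univ (α := V), this]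
    refine Finset.card_le_card_of_injOn (fun q => Function.update q.1 a q.2) (fun _ _ => by simp) ?_
    rintro ⟨f, v⟩ hf ⟨g, w⟩ hg h
    simp only [coe_product, Set.mem_prod, mem_coe, mem_filter, mem_univ, true_and, and_true] at hf hg
    simp only at h
    have hx : ∀ x, x ≠ a → f x = g x := fun x hx => by
      simpa [hx] using congrFun h x
    have hv : v = w := by simpa using congrFun h a
    have : f = g := by
      funext x
      by_cases hxa : x = a
      · subst hxa; rw [hf, hg]; exact hx b (Ne.symm hp)
      · exact hx x hxa
    rw [this, hv]
  calc _ ≤ (∑ p ∈ univ.filter (fun p : ι × ι => p.1 ≠ p.2), #{f : ι → V | f p.1 = f p.2}) * Fintype.card V :=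
        Nat.mul_le_mul_right _ ((card_le_card h1).trans card_biUnion_le)
    _ = ∑ p ∈ univ.filter (fun p : ι × ι => p.1 ≠ p.2), #{f : ι → V | f p.1 = f p.2} * Fintype.card V := by
        rw [Finset.sum_mul]
    _ ≤ #(univ.filter fun p : ι × ι => p.1 ≠ p.2) • Fintype.card V ^ Fintype.card ι :=
        Finset.sum_le_card_nsmul _ _ _ h2
    _ ≤ _ := by
        rw [smul_eq_mul]
        refine Nat.mul_le_mul_right _ ((card_le_univ _).trans ?_)
        simp [sq]

open Finset in
lemma es_count (l t : ℕ) (ht : 0 < t) (ε : ℝ) (hε : 0 < ε) (n : ℕ) (hn : 0 < n) (hnl : 2 * l ≤ n)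
    (H : Finset (Finset (Fin n))) (hH : ∀ e ∈ H, e.card = l)
    (hHc : ε * (n.choose l : ℝ) ≤ (H.card : ℝ)) :
    (ε / (2 ^ l * l.factorial)) ^ (t ^ l) * (n : ℝ) ^ (l * t) ≤
      (Nat.card {f : Fin l × Fin t → Fin n //
          Function.Injective f ∧
          ∀ g : Fin l → Fin t,
            (Finset.univ.image fun i => f (i, g i)) ∈ H} : ℝ)
        + ((l * t : ℕ) : ℝ) ^ 2 * (n : ℝ) ^ (l * t) / n := by
  have : Nonempty (Fin n) := ⟨⟨0, hn⟩⟩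
  have hn' : (0:ℝ) < n := by exact_mod_cast hn
  let A : Finset (Fin l → Fin n) := {x | univ.image x ∈ H}
  have hA : #H ≤ #A := by
    have : H ⊆ A.image fun x => univ.image x := by
      intro e he
      have hi : univ.image (e.orderEmbOfFin (hH e he)) = e := by
        apply Finset.coe_injective
        simp
      refine mem_image.2 ⟨e.orderEmbOfFin (hH e he), ?_, hi⟩
      simp only [A, mem_filter, mem_univ, true_and]
      rwa [hi]
    exact (card_le_card this).trans card_image_le
  have hdens : ε / (2 ^ l * l.factorial) ≤ (#A : ℝ) / (n : ℝ) ^ l := by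
    have h1 : ((n + 1 - l : ℕ) : ℝ) ^ l ≤ l.factorial * n.choose l := by
      have := Nat.pow_sub_le_descFactorial n l
      rw [Nat.descFactorial_eq_factorial_mul_choose] at this
      exact_mod_cast this
    have h2 : (n : ℝ) / 2 ≤ ((n + 1 - l : ℕ) : ℝ) := by
      rw [div_le_iff₀ (by norm_num)]
      have : n ≤ (n + 1 - l) * 2 := by omega
      exact_mod_cast this
    have h3 : ((n : ℝ) / 2) ^ l ≤ l.factorial * n.choose l := le_trans (by gcongr) h1
    have h4 : (#H : ℝ) ≤ #A := by exact_mod_cast hA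
    rw [div_pow, div_le_iff₀ (by positivity)] at h3
    rw [div_le_div_iff₀ (by positivity) (by positivity)]
    calc ε * (n : ℝ) ^ l ≤ ε * (l.factorial * n.choose l * 2 ^ l) := by gcongr
      _ = (ε * n.choose l) * (2 ^ l * l.factorial) := by ring
      _ ≤ _ := by gcongr; exact hHc.trans h4
  have hhom := es_hom (V := Fin n) t ht l A
  rw [Fintype.card_fin] at hhom
  set N1 := #{f : Fin l → Fin t → Fin n | ∀ g : Fin l → Fin t, (fun i => f i (g i)) ∈ A} with hN1
  have hN1' : N1 = #{f : Fin l × Fin t → Fin n | ∀ g : Fin l → Fin t,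
      (Finset.univ.image fun i => f (i, g i)) ∈ H} := by
    rw [hN1]
    simp only [A, mem_filter, mem_univ, true_and, Finset.card_filter]
    exact Fintype.sum_equiv (Equiv.curry _ _ _).symm _ _ (fun x => rfl)
  have hsplit : N1 ≤ #{f : Fin l × Fin t → Fin n | Function.Injective f ∧ ∀ g : Fin l → Fin t,
      (Finset.univ.image fun i => f (i, g i)) ∈ H} + #{f : Fin l × Fin t → Fin n | ¬ Function.Injective f} := by
    rw [hN1']
    refine le_trans (card_le_card ?_) (card_union_le _ _)
    intro f hf
    simp only [mem_union, mem_filter, mem_univ, true_and] at hf ⊢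
    tauto
  have hni := es_noninj (ι := Fin l × Fin t) (V := Fin n)
  simp only [Fintype.card_prod, Fintype.card_fin] at hni
  have hni' : (#{f : Fin l × Fin t → Fin n | ¬ Function.Injective f} : ℝ) ≤
      ((l * t : ℕ) : ℝ) ^ 2 * (n : ℝ) ^ (l * t) / n := by
    rw [le_div_iff₀ hn']
    exact_mod_cast hni
  rw [Nat.card_eq_fintype_card, Fintype.card_subtype]
  calc _ ≤ ((#A : ℝ) / (n : ℝ) ^ l) ^ (t ^ l) * (n : ℝ) ^ (l * t) := by gcongr
    _ ≤ N1 := hhom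
    _ ≤ _ := (Nat.cast_le (α := ℝ)).2 hsplit
    _ ≤ _ := by push_cast at hni' ⊢; gcongr


/-- Erdős–Simonovits supersaturation: for all positive integers `l`, `t` and
`ε > 0` there is `δ > 0` such that every `l`-uniform hypergraph `H` on `n`
vertices with at least `ε·C(n,l)` edges contains at least `⌊δ·n^(l·t)⌋` copies
of the complete `l`-partite `l`-uniform hypergraph `K^l(t)` (a copy being an
injection `f : Fin l × Fin t → Fin n` with all transversal edges present). -/
theorem erdos_simonovits (l t : ℕ) (hl : 0 < l) (ht : 0 < t)
    (ε : ℝ) (hε : 0 < ε) :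
    ∃ δ : ℝ, 0 < δ ∧ ∀ (n : ℕ) (H : Finset (Finset (Fin n))),
      (∀ e ∈ H, e.card = l) → ε * (n.choose l : ℝ) ≤ (H.card : ℝ) →
      ⌊δ * (n : ℝ) ^ (l * t)⌋ ≤
        (Nat.card {f : Fin l × Fin t → Fin n //
          Function.Injective f ∧
          ∀ g : Fin l → Fin t,
            (Finset.univ.image fun i => f (i, g i)) ∈ H} : ℤ) := by
  set K : ℝ := (ε / (2 ^ l * l.factorial)) ^ (t ^ l) with hK
  have hK0 : 0 < K := by positivity
  obtain ⟨m, hm⟩ := exists_nat_ge (2 * ((l * t : ℕ) : ℝ) ^ 2 / K)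
  set n0 : ℕ := max (2 * l) m with hn0
  have hn0pos : 0 < n0 := by omega
  have hn0' : (0:ℝ) < n0 := by exact_mod_cast hn0pos
  refine ⟨min (K / 2) (1 / (2 * (n0 : ℝ) ^ (l * t))), by positivity, ?_⟩
  intro n H hH hHc
  rcases lt_or_ge n n0 with hlt | hge
  · have h0 : ⌊min (K / 2) (1 / (2 * (n0 : ℝ) ^ (l * t))) * (n : ℝ) ^ (l * t)⌋ ≤ 0 := by
      rw [← Int.lt_add_one_iff, Int.floor_lt]
      have h1 : (n : ℝ) ^ (l * t) ≤ (n0 : ℝ) ^ (l * t) := by gcongr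
      calc _ ≤ 1 / (2 * (n0 : ℝ) ^ (l * t)) * (n0 : ℝ) ^ (l * t) := by
            gcongr
            exact min_le_right _ _
        _ = 1 / 2 := by field_simp
        _ < _ := by norm_num
    exact h0.trans (by positivity)
  · have hnpos : 0 < n := by omega
    have hn' : (0:ℝ) < n := by exact_mod_cast hnpos
    have hc := es_count l t ht ε hε n hnpos (by omega) H hH hHc
    rw [← hK] at hc
    have hmn : (m : ℝ) ≤ n := by exact_mod_cast (by omega : m ≤ n)
    have h2 := hm.trans hmn
    rw [div_le_iff₀ hK0] at h2
    have h3 : ((l * t : ℕ) : ℝ) ^ 2 * (n : ℝ) ^ (l * t) / n ≤ K / 2 * (n : ℝ) ^ (l * t) := by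
      rw [div_le_iff₀ hn']
      have h4 : ((l * t : ℕ) : ℝ) ^ 2 ≤ K / 2 * n := by linarith
      calc _ ≤ K / 2 * n * (n : ℝ) ^ (l * t) := by gcongr
        _ = _ := by ring
    have h5 : min (K / 2) (1 / (2 * (n0 : ℝ) ^ (l * t))) * (n : ℝ) ^ (l * t) ≤
        K / 2 * (n : ℝ) ^ (l * t) := by
      gcongr
      exact min_le_left _ _
    have h6 := (h5.trans (by linarith : _ ≤ (Nat.card {f : Fin l × Fin t → Fin n //
          Function.Injective f ∧
          ∀ g : Fin l → Fin t,
            (Finset.univ.image fun i => f (i, g i)) ∈ H} : ℝ)))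
    have h7 := (Int.floor_le _).trans h6
    exact_mod_cast h7
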